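/- Suppose Conditions 2.1, 4.1 (with parameter θ₁) and 4.3 (with parameters θ₂, θ₃) are met. Then for any c ∈ (0,1) and any ω ∈ (0, min{ θ₁/(2(1−θ₁)), θ₂/(2(1−θ₂)), θ₃ − 1/2 }): sup_{u ∈ N(c n^{−1}, 1/2)} | ĈP_n(u)/g_ω(u) − 𝔺_n(u)/g_ω(u) | = o_P(1) as n → ∞. -/

import Mathlib

open MeasureTheory Filter Set
open scoped ENNReal NNReal

noncomputable section

namespace BBV

variable {Ω : Type*} [MeasurableSpace Ω] {E : Type*} [MeasurableSpace E] {d : ℕ}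

/-- The real-valued indicator function of a set. -/
def indic {α : Type*} (s : Set α) (x : α) : ℝ := s.indicator (fun _ => (1 : ℝ)) x

/-- `Z n = o_P(r n)`: convergence to zero in (outer) probability at rate `r`. -/
def oP (P : Measure Ω) (Z : ℕ → Ω → ℝ) (r : ℕ → ℝ) : Prop :=
  ∀ ε : ℝ, 0 < ε → Tendsto (fun n => P {ω | ε * r n < |Z n ω|}) atTop (nhds 0)

/-- `Z n = o_P(1)`: convergence to zero in (outer) probability. -/
def oP1 (P : Measure Ω) (Z : ℕ → Ω → ℝ) : Prop := oP P Z fun _ => 1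

/-- `Z n = O_P(1)`: boundedness in (outer) probability. -/
def bigOP (P : Measure Ω) (Z : ℕ → Ω → ℝ) : Prop :=
  ∀ ε : ℝ, 0 < ε → ∃ M : ℝ, ∀ᶠ n in atTop, P {ω | M < |Z n ω|} ≤ ENNReal.ofReal ε

/-- Strict stationarity of a two-sided sequence: all finite-dimensional distributions
are invariant under shifts. -/
def StrictlyStationary (P : Measure Ω) (X : ℤ → Ω → E) : Prop :=
  ∀ (m : ℕ) (idx : Fin m → ℤ) (k : ℤ),
    Measure.map (fun ω (p : Fin m) => X (idx p + k) ω) P =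
      Measure.map (fun ω (p : Fin m) => X (idx p) ω) P

/-- The sigma-field generated by the variables `X i`, `i ∈ S`. -/
def mixSigma (X : ℤ → Ω → E) (S : Set ℤ) : MeasurableSpace Ω :=
  ⨆ i ∈ S, MeasurableSpace.comap (X i) inferInstance

/-- The alpha-mixing coefficient of the sequence `X`. -/
def alphaMix (P : Measure Ω) (X : ℤ → Ω → E) (k : ℕ) : ℝ :=
  sSup {r : ℝ | ∃ (i : ℤ) (A B : Set Ω),
    MeasurableSet[mixSigma X (Set.Iic i)] A ∧
    MeasurableSet[mixSigma X (Set.Ici (i + (k : ℤ)))] B ∧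
    r = |(P (A ∩ B)).toReal - (P A).toReal * (P B).toReal|}

/-- Exponentially decaying alpha-mixing coefficients: `α(k) = O(a^k)` for some `a ∈ (0,1)`. -/
def ExpAlphaMixing (P : Measure Ω) (X : ℤ → Ω → E) : Prop :=
  ∃ a ∈ Set.Ioo (0 : ℝ) 1, ∃ c : ℝ, ∀ k : ℕ, 1 ≤ k → alphaMix P X k ≤ c * a ^ k

/-- Marginal c.d.f. `F_j` of the stationary sequence. -/
def margF (P : Measure Ω) (X : ℤ → Ω → Fin d → ℝ) (j : Fin d) (x : ℝ) : ℝ :=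
  (P {ω | X 0 ω j ≤ x}).toReal

/-- `U_i = (F_1(X_{i1}),…,F_d(X_{id}))`. -/
def Uv (P : Measure Ω) (X : ℤ → Ω → Fin d → ℝ) (i : ℤ) (ω : Ω) (j : Fin d) : ℝ :=
  margF P X j (X i ω j)

/-- The copula `C` of the stationary distribution, i.e. the c.d.f. of `U_0`. -/
def cop (P : Measure Ω) (X : ℤ → Ω → Fin d → ℝ) (u : Fin d → ℝ) : ℝ :=
  (P {ω | ∀ j, Uv P X 0 ω j ≤ u j}).toReal

/-- Empirical c.d.f. `G_n` of the (unobservable) sample `U_1,…,U_n`. -/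
def Gn (P : Measure Ω) (X : ℤ → Ω → Fin d → ℝ) (n : ℕ) (u : Fin d → ℝ) (ω : Ω) : ℝ :=
  (n : ℝ)⁻¹ * ∑ i ∈ Finset.Icc (1 : ℤ) (n : ℤ), indic {ω' | ∀ j, Uv P X i ω' j ≤ u j} ω

/-- The empirical process `α_n = √n (G_n − C)`. -/
def alphan (P : Measure Ω) (X : ℤ → Ω → Fin d → ℝ) (n : ℕ) (u : Fin d → ℝ) (ω : Ω) : ℝ :=
  Real.sqrt n * (Gn P X n u ω - cop P X u)

/-- Marginal empirical c.d.f. `G_{nj}` based on `U_{1j},…,U_{nj}`. -/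
def Gnj (P : Measure Ω) (X : ℤ → Ω → Fin d → ℝ) (n : ℕ) (j : Fin d) (s : ℝ) (ω : Ω) : ℝ :=
  (n : ℝ)⁻¹ * ∑ i ∈ Finset.Icc (1 : ℤ) (n : ℤ), indic {ω' | Uv P X i ω' j ≤ s} ω

/-- The marginal empirical process `α_{nj}(s) = √n (G_{nj}(s) − s)`. -/
def alphanj (P : Measure Ω) (X : ℤ → Ω → Fin d → ℝ) (n : ℕ) (j : Fin d) (s : ℝ) (ω : Ω) : ℝ :=
  Real.sqrt n * (Gnj P X n j s ω - s)

/-- Left-continuous generalized inverse: `H⁻(s) = inf{x : H(x) ≥ s}` for `s ≠ 0`,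
and `H⁻(0) = sup{x : H(x) = 0}`. -/
def genInv (H : ℝ → ℝ) (s : ℝ) : ℝ :=
  if s = 0 then sSup {x | H x = 0} else sInf {x | s ≤ H x}

/-- The marginal quantile process `β_{nj}(s) = √n (G_{nj}⁻(s) − s)`. -/
def betanj (P : Measure Ω) (X : ℤ → Ω → Fin d → ℝ) (n : ℕ) (j : Fin d) (s : ℝ) (ω : Ω) : ℝ :=
  Real.sqrt n * (genInv (fun x => Gnj P X n j x ω) s - s)

/-- Marginal empirical c.d.f. `F_{nj}` of the observations `X_{1j},…,X_{nj}`. -/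
def empCdfX (X : ℤ → Ω → Fin d → ℝ) (n : ℕ) (j : Fin d) (x : ℝ) (ω : Ω) : ℝ :=
  (n : ℝ)⁻¹ * ∑ i ∈ Finset.Icc (1 : ℤ) (n : ℤ), indic {ω' | X i ω' j ≤ x} ω

/-- Pseudo-observations `Û_{ij} = n/(n+1) · F_{nj}(X_{ij})`. -/
def pseudoObs (X : ℤ → Ω → Fin d → ℝ) (n : ℕ) (i : ℤ) (ω : Ω) (j : Fin d) : ℝ :=
  (n : ℝ) / ((n : ℝ) + 1) * empCdfX X n j (X i ω j) ω

/-- The empirical copula `Ĉ_n`. -/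
def empCop (X : ℤ → Ω → Fin d → ℝ) (n : ℕ) (u : Fin d → ℝ) (ω : Ω) : ℝ :=
  (n : ℝ)⁻¹ * ∑ i ∈ Finset.Icc (1 : ℤ) (n : ℤ), indic {ω' | ∀ j, pseudoObs X n i ω' j ≤ u j} ω

/-- The empirical copula process `ĈP_n = √n (Ĉ_n − C)`. -/
def hatCP (P : Measure Ω) (X : ℤ → Ω → Fin d → ℝ) (n : ℕ) (u : Fin d → ℝ) (ω : Ω) : ℝ :=
  Real.sqrt n * (empCop X n u ω - cop P X u)

/-- First-order partial derivative `Ċ_j` of `C`, defined everywhere as the limsup of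
difference quotients (which coincides with the partial derivative wherever it exists). -/
def Cdot (C : (Fin d → ℝ) → ℝ) (j : Fin d) (u : Fin d → ℝ) : ℝ :=
  Filter.limsup (fun h : ℝ => (C (Function.update u j (u j + h)) - C u) / h)
    (nhdsWithin 0 {(0 : ℝ)}ᶜ)

/-- The process `C̄_n(u) = α_n(u) − Σ_j Ċ_j(u) α_n(u^{(j)})`. -/
def Cbar (P : Measure Ω) (X : ℤ → Ω → Fin d → ℝ) (n : ℕ) (u : Fin d → ℝ) (ω : Ω) : ℝ :=
  alphan P X n u ω -
    ∑ j, Cdot (cop P X) j u * alphan P X n (Function.update (fun _ => (1 : ℝ)) j (u j)) ω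

/-- `C_n(u) = G_n(G_{n1}⁻(u₁),…,G_{nd}⁻(u_d))`. -/
def copGI (P : Measure Ω) (X : ℤ → Ω → Fin d → ℝ) (n : ℕ) (u : Fin d → ℝ) (ω : Ω) : ℝ :=
  Gn P X n (fun j => genInv (fun x => Gnj P X n j x ω) (u j)) ω

/-- The empirical copula process `𝔺_n = √n (C_n − C)` based on generalized inverses. -/
def CPgi (P : Measure Ω) (X : ℤ → Ω → Fin d → ℝ) (n : ℕ) (u : Fin d → ℝ) (ω : Ω) : ℝ :=
  Real.sqrt n * (copGI P X n u ω - cop P X u)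

/-- `g₁(u) = min{ min_j u_j , min_j [1 − min_{k ≠ j} u_k] }`. -/
def g1 (u : Fin d → ℝ) : ℝ :=
  min (⨅ j, u j) (⨅ j : Fin d, (1 - ⨅ k : {k : Fin d // k ≠ j}, u (k : Fin d)))

/-- The weight function `g_ω(u) = g₁(u)^ω`. -/
def gW (w : ℝ) (u : Fin d → ℝ) : ℝ := g1 u ^ w

/-- `g̃_ω(u) = g_ω(u) + 1{g_ω(u) = 0}`. -/
def gTilde (w : ℝ) (u : Fin d → ℝ) : ℝ := if gW w u = 0 then 1 else gW w u

/-- `N(a,b) = {u ∈ [0,1]^d : a < g₁(u) ≤ b}`. -/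
def NN (d : ℕ) (a b : ℝ) : Set (Fin d → ℝ) :=
  {u | (∀ j, 0 ≤ u j ∧ u j ≤ 1) ∧ a < g1 u ∧ g1 u ≤ b}

/-- `V_j = {u ∈ [0,1]^d : u_j ∈ (0,1)}`. -/
def VV (d : ℕ) (j : Fin d) : Set (Fin d → ℝ) :=
  {u | (∀ k, 0 ≤ u k ∧ u k ≤ 1) ∧ 0 < u j ∧ u j < 1}

/-- Condition 2.1: existence, continuity and growth bounds for the first and second
order partial derivatives of the copula `C`. -/
def Condition21 (C : (Fin d → ℝ) → ℝ) : Prop :=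
  (∀ j : Fin d, ∀ u ∈ VV d j,
    HasDerivAt (fun t => C (Function.update u j t)) (Cdot C j u) (u j)) ∧
  (∀ j : Fin d, ContinuousOn (Cdot C j) (VV d j)) ∧
  ∃ Cdd : Fin d → Fin d → (Fin d → ℝ) → ℝ,
    (∀ j₁ j₂ : Fin d, ∀ u ∈ VV d j₁ ∩ VV d j₂,
      HasDerivAt (fun t => Cdot C j₂ (Function.update u j₁ t)) (Cdd j₁ j₂ u) (u j₁)) ∧
    (∀ j₁ j₂ : Fin d, ContinuousOn (Cdd j₁ j₂) (VV d j₁ ∩ VV d j₂)) ∧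
    ∃ K : ℝ, 0 < K ∧ ∀ j₁ j₂ : Fin d, ∀ u ∈ VV d j₁ ∩ VV d j₂,
      |Cdd j₁ j₂ u| ≤ K * min (1 / (u j₁ * (1 - u j₁))) (1 / (u j₂ * (1 - u j₂)))

/-- The weighted modulus of continuity `M_n(δ,μ)` of the empirical process. -/
def Mn (P : Measure Ω) (X : ℤ → Ω → Fin d → ℝ) (n : ℕ) (δ μ : ℝ) (ω : Ω) : ℝ :=
  ⨆ q ∈ {q : (Fin d → ℝ) × (Fin d → ℝ) |
      q.1 ∈ Set.Icc 0 1 ∧ q.2 ∈ Set.Icc 0 1 ∧ dist q.1 q.2 ≤ δ},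
    |alphan P X n q.1 ω - alphan P X n q.2 ω| / max (dist q.1 q.2 ^ μ) ((n : ℝ) ^ (-μ))

/-- Condition 4.1 with parameter `θ₁`. -/
def Condition41 (P : Measure Ω) (X : ℤ → Ω → Fin d → ℝ) (θ₁ : ℝ) : Prop :=
  ∀ μ ∈ Set.Ioo (0 : ℝ) θ₁, ∀ δ : ℕ → ℝ, Tendsto δ atTop (nhds 0) →
    oP1 P (fun n ω => Mn P X n (δ n) μ ω)

/-- Condition 4.3 with parameters `θ₂, θ₃`. -/
def Condition43 (P : Measure Ω) (X : ℤ → Ω → Fin d → ℝ) (θ₂ θ₃ : ℝ) : Prop :=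
  ∀ w ∈ Set.Ioo (0 : ℝ) θ₂, ∀ lam ∈ Set.Ioo (0 : ℝ) θ₃, ∀ j : Fin d,
    bigOP P (fun n ω => ⨆ s ∈ Set.Ioo (0 : ℝ) 1,
      |alphanj P X n j s ω| / (s * (1 - s)) ^ w) ∧
    bigOP P (fun n ω => ⨆ s ∈ Set.Ioo ((n : ℝ) ^ (-lam)) (1 - (n : ℝ) ^ (-lam)),
      |betanj P X n j s ω| / (s * (1 - s)) ^ w)

lemma indic_nonneg {α : Type*} (s : Set α) (x : α) : 0 ≤ indic s x :=
  Set.indicator_nonneg (fun _ _ => zero_le_one) x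

lemma indic_of_mem {α : Type*} {s : Set α} {x : α} (h : x ∈ s) : indic s x = 1 :=
  Set.indicator_of_mem h _

lemma indic_of_notMem {α : Type*} {s : Set α} {x : α} (h : x ∉ s) : indic s x = 0 :=
  Set.indicator_of_notMem h _

lemma indic_le_one {α : Type*} (s : Set α) (x : α) : indic s x ≤ 1 := by
  by_cases h : x ∈ s
  · exact (indic_of_mem h).le
  · exact (indic_of_notMem h).le.trans zero_le_one

lemma indic_le_indic {α : Type*} {s t : Set α} {x : α} (h : x ∈ s → x ∈ t) :
    indic s x ≤ indic t x := by
  by_cases hs : x ∈ s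
  · rw [indic_of_mem hs, indic_of_mem (h hs)]
  · rw [indic_of_notMem hs]
    exact indic_nonneg t x

lemma margF_monotone (P : Measure Ω) [IsProbabilityMeasure P] (X : ℤ → Ω → Fin d → ℝ)
    (j : Fin d) : Monotone (margF P X j) := fun _ _ hab =>
  ENNReal.toReal_mono (measure_ne_top _ _) (measure_mono fun _ h => le_trans h hab)

lemma Uv_nonneg (P : Measure Ω) (X : ℤ → Ω → Fin d → ℝ) (i : ℤ) (ω : Ω) (j : Fin d) :
    0 ≤ Uv P X i ω j := ENNReal.toReal_nonneg

lemma Uv_le_one (P : Measure Ω) [IsProbabilityMeasure P] (X : ℤ → Ω → Fin d → ℝ) (i : ℤ)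
    (ω : Ω) (j : Fin d) : Uv P X i ω j ≤ 1 := measureReal_le_one

lemma margF_eq_cdf (P : Measure Ω) [IsProbabilityMeasure P] (X : ℤ → Ω → Fin d → ℝ)
    (hX : Measurable (X 0)) (j : Fin d) :
    margF P X j = ProbabilityTheory.cdf (P.map fun ω => X 0 ω j) := by
  have hm : Measurable fun ω => X 0 ω j := (measurable_pi_apply j).comp hX
  have := Measure.isProbabilityMeasure_map (μ := P) hm.aemeasurable
  ext x
  rw [ProbabilityTheory.cdf_eq_real, measureReal_def, Measure.map_apply hm measurableSet_Iic]
  rfl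

/-- Every level strictly between `0` and `1` is attained by a continuous marginal c.d.f. -/
lemma exists_margF_eq (P : Measure Ω) [IsProbabilityMeasure P] (X : ℤ → Ω → Fin d → ℝ)
    (hX : Measurable (X 0)) (j : Fin d) (hcont : Continuous (margF P X j))
    {s : ℝ} (hs : s ∈ Set.Ioo (0 : ℝ) 1) : ∃ x, margF P X j x = s := by
  have hm : Measurable fun ω => X 0 ω j := (measurable_pi_apply j).comp hX
  have := Measure.isProbabilityMeasure_map (μ := P) hm.aemeasurable
  have hF := margF_eq_cdf P X hX j
  obtain ⟨a, ha⟩ := ((ProbabilityTheory.tendsto_cdf_atBot (P.map fun ω => X 0 ω j)).eventually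
    (gt_mem_nhds hs.1)).exists
  obtain ⟨b, hb⟩ := ((ProbabilityTheory.tendsto_cdf_atTop (P.map fun ω => X 0 ω j)).eventually
    (lt_mem_nhds hs.2)).exists
  rw [← hF] at ha hb
  exact mem_range_of_exists_le_of_exists_ge hcont ⟨a, ha.le⟩ ⟨b, hb.le⟩

lemma measureReal_Uv_lt_le (P : Measure Ω) [IsProbabilityMeasure P] (X : ℤ → Ω → Fin d → ℝ)
    (hX : Measurable (X 0)) (j : Fin d) (hcont : Continuous (margF P X j))
    {s : ℝ} (hs : s ∈ Set.Ioo (0 : ℝ) 1) : P.real {ω | Uv P X 0 ω j < s} ≤ s := by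
  obtain ⟨x, hx⟩ := exists_margF_eq P X hX j hcont hs
  calc P.real {ω | Uv P X 0 ω j < s} ≤ P.real {ω | X 0 ω j ≤ x} := by
        refine measureReal_mono fun ω (h : margF P X j (X 0 ω j) < s) => ?_
        exact ((margF_monotone P X j).reflect_lt (hx ▸ h)).le
    _ = s := hx

/-- The probability integral transform. -/
lemma measureReal_Uv_le (P : Measure Ω) [IsProbabilityMeasure P] (X : ℤ → Ω → Fin d → ℝ)
    (hX : Measurable (X 0)) (j : Fin d) (hcont : Continuous (margF P X j))
    {s : ℝ} (hs : s ∈ Set.Icc (0 : ℝ) 1) : P.real {ω | Uv P X 0 ω j ≤ s} = s := by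
  rcases hs.2.eq_or_lt with rfl | hs1
  · have : {ω | Uv P X 0 ω j ≤ 1} = Set.univ :=
      Set.eq_univ_of_forall fun ω => Uv_le_one P X 0 ω j
    rw [this, probReal_univ]
  refine le_antisymm ?_ ?_
  · refine le_of_forall_gt_imp_ge_of_dense fun t ht => ?_
    rcases le_or_gt 1 t with h1 | h1
    · exact measureReal_le_one.trans h1
    · exact (measureReal_mono fun ω h => lt_of_le_of_lt h ht).trans
        (measureReal_Uv_lt_le P X hX j hcont ⟨hs.1.trans_lt ht, h1⟩)
  · rcases hs.1.eq_or_lt with rfl | hs0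
    · exact measureReal_nonneg
    · obtain ⟨x, hx⟩ := exists_margF_eq P X hX j hcont ⟨hs0, hs1⟩
      calc s = P.real {ω | X 0 ω j ≤ x} := hx.symm
        _ ≤ _ := measureReal_mono fun ω h => (margF_monotone P X j h).trans hx.le

lemma measure_Uv_nonpos (P : Measure Ω) [IsProbabilityMeasure P] (X : ℤ → Ω → Fin d → ℝ)
    (hmeas : ∀ i, Measurable (X i)) (hstat : StrictlyStationary P X)
    (j : Fin d) (hcont : Continuous (margF P X j)) (i : ℤ) :
    P {ω | Uv P X i ω j ≤ 0} = 0 := by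
  have hS : MeasurableSet {y : Fin 1 → Fin d → ℝ | margF P X j (y 0 j) ≤ 0} :=
    measurableSet_le (hcont.measurable.comp (by fun_prop)) measurable_const
  have h := congrArg (fun ν => ν {y : Fin 1 → Fin d → ℝ | margF P X j (y 0 j) ≤ 0})
    (hstat 1 (fun _ => 0) i)
  rw [Measure.map_apply (measurable_pi_lambda _ fun _ => hmeas _) hS,
    Measure.map_apply (measurable_pi_lambda _ fun _ => hmeas _) hS] at h
  have h0 : P {ω | Uv P X 0 ω j ≤ 0} = 0 := by
    have := measureReal_Uv_le P X (hmeas 0) j hcont (s := 0) ⟨le_rfl, zero_le_one⟩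
    exact (measureReal_eq_zero_iff (measure_ne_top _ _)).1 this
  rw [zero_add] at h
  exact h.trans h0

/-- The point of the cube with `j`-th coordinate `s` and all other coordinates `1`. -/
def margPt (j : Fin d) (s : ℝ) : Fin d → ℝ := Function.update (fun _ => (1 : ℝ)) j s

lemma forall_Uv_le_margPt (P : Measure Ω) [IsProbabilityMeasure P] (X : ℤ → Ω → Fin d → ℝ)
    (i : ℤ) (ω : Ω) (j : Fin d) (s : ℝ) :
    (∀ k, Uv P X i ω k ≤ margPt j s k) ↔ Uv P X i ω j ≤ s := by
  constructor
  · intro h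
    simpa [margPt] using h j
  · intro h k
    by_cases hk : k = j
    · subst hk
      simpa [margPt] using h
    · simpa [margPt, hk] using Uv_le_one P X i ω k

lemma margPt_mem_Icc (j : Fin d) {s : ℝ} (hs : s ∈ Set.Icc (0 : ℝ) 1) :
    margPt j s ∈ Set.Icc (0 : Fin d → ℝ) 1 := by
  constructor <;> intro k <;> by_cases hk : k = j
  · subst hk; simpa [margPt] using hs.1
  · simp [margPt, hk]
  · subst hk; simpa [margPt] using hs.2
  · simp [margPt, hk]

lemma dist_margPt (j : Fin d) (s t : ℝ) : dist (margPt j s) (margPt j t) = |s - t| := by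
  refine le_antisymm ((dist_pi_le_iff (abs_nonneg _)).2 fun k => ?_) ?_
  · by_cases hk : k = j
    · subst hk; simp [margPt, Real.dist_eq]
    · simp [margPt, hk]
  · simpa [margPt, Real.dist_eq] using dist_le_pi_dist (margPt j s) (margPt j t) j

lemma alphan_margPt (P : Measure Ω) [IsProbabilityMeasure P] (X : ℤ → Ω → Fin d → ℝ)
    (hX : Measurable (X 0)) (j : Fin d) (hcont : Continuous (margF P X j)) (n : ℕ) (ω : Ω)
    {s : ℝ} (hs : s ∈ Set.Icc (0 : ℝ) 1) :
    alphan P X n (margPt j s) ω = Real.sqrt n * (Gnj P X n j s ω - s) := by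
  have hC : cop P X (margPt j s) = s := by
    simp only [cop, forall_Uv_le_margPt]
    exact measureReal_Uv_le P X hX j hcont hs
  simp only [alphan, hC, Gn, Gnj, forall_Uv_le_margPt]

lemma inv_mul_sum_indic_mem_Icc {α : Type*} (n : ℕ) (s : ℤ → Set α) (ω : α) :
    (n : ℝ)⁻¹ * ∑ i ∈ Finset.Icc (1 : ℤ) (n : ℤ), indic (s i) ω ∈ Set.Icc (0 : ℝ) 1 := by
  refine ⟨mul_nonneg (by positivity) (Finset.sum_nonneg fun i _ => indic_nonneg _ _), ?_⟩
  have h : ∑ i ∈ Finset.Icc (1 : ℤ) (n : ℤ), indic (s i) ω ≤ n := by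
    refine (Finset.sum_le_sum fun i _ => indic_le_one _ _).trans ?_
    simp
  rcases Nat.eq_zero_or_pos n with rfl | hn
  · simp
  · have hn' : (0 : ℝ) < n := by exact_mod_cast hn
    rw [inv_mul_le_iff₀ hn']
    simpa using h

lemma abs_alphan_le (P : Measure Ω) [IsProbabilityMeasure P] (X : ℤ → Ω → Fin d → ℝ) (n : ℕ)
    (u : Fin d → ℝ) (ω : Ω) : |alphan P X n u ω| ≤ Real.sqrt n := by
  have hG : Gn P X n u ω ∈ Set.Icc (0 : ℝ) 1 := inv_mul_sum_indic_mem_Icc n _ ω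
  have h0 : 0 ≤ cop P X u := ENNReal.toReal_nonneg
  have h1 : cop P X u ≤ 1 := measureReal_le_one
  rw [alphan, abs_mul, abs_of_nonneg (Real.sqrt_nonneg _)]
  refine mul_le_of_le_one_right (Real.sqrt_nonneg _) (abs_le.2 ⟨?_, ?_⟩) <;>
    linarith [hG.1, hG.2]

/-- The weighted modulus of continuity controls increments of the empirical process. -/
lemma abs_alphan_sub_le (P : Measure Ω) [IsProbabilityMeasure P] (X : ℤ → Ω → Fin d → ℝ)
    {n : ℕ} (hn : 0 < n) (δ μ : ℝ) (ω : Ω) {u v : Fin d → ℝ} (hu : u ∈ Set.Icc 0 1)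
    (hv : v ∈ Set.Icc 0 1) (huv : dist u v ≤ δ) :
    |alphan P X n u ω - alphan P X n v ω| ≤
      Mn P X n δ μ ω * max (dist u v ^ μ) ((n : ℝ) ^ (-μ)) := by
  have hn' : (0 : ℝ) < (n : ℝ) ^ (-μ) := Real.rpow_pos_of_pos (by exact_mod_cast hn) _
  have hpos : ∀ q : (Fin d → ℝ) × (Fin d → ℝ),
      0 < max (dist q.1 q.2 ^ μ) ((n : ℝ) ^ (-μ)) := fun q => lt_max_of_lt_right hn'
  set B : ℝ := 2 * Real.sqrt n / (n : ℝ) ^ (-μ) with hB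
  have hB0 : 0 ≤ B := by positivity
  have hbound : ∀ q : (Fin d → ℝ) × (Fin d → ℝ),
      |alphan P X n q.1 ω - alphan P X n q.2 ω| /
        max (dist q.1 q.2 ^ μ) ((n : ℝ) ^ (-μ)) ≤ B := fun q => by
    refine div_le_div₀ (by positivity) ?_ hn' (le_max_right _ _)
    refine (abs_sub _ _).trans ?_
    linarith [abs_alphan_le P X n q.1 ω, abs_alphan_le P X n q.2 ω]
  rw [← div_le_iff₀ (hpos (u, v))]
  have hmem : (u, v) ∈ {q : (Fin d → ℝ) × (Fin d → ℝ) |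
      q.1 ∈ Set.Icc 0 1 ∧ q.2 ∈ Set.Icc 0 1 ∧ dist q.1 q.2 ≤ δ} := ⟨hu, hv, huv⟩
  refine le_trans ?_ (le_ciSup ⟨B, ?_⟩ (u, v))
  · rw [ciSup_pos hmem]
  · rintro _ ⟨q, rfl⟩
    exact Real.iSup_le (fun _ => hbound q) hB0

/-- A bound on the proportion of ties at a level `s > 0`. -/
lemma sqrt_mul_ties_le (P : Measure Ω) [IsProbabilityMeasure P] (X : ℤ → Ω → Fin d → ℝ)
    (hX : Measurable (X 0)) (j : Fin d) (hcont : Continuous (margF P X j))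
    {n : ℕ} (hn : 0 < n) {μ : ℝ} (hμ : 0 ≤ μ) (ω : Ω) {s : ℝ} (hs : s ∈ Set.Ioc (0 : ℝ) 1) :
    Real.sqrt n * ((n : ℝ)⁻¹ * ∑ i ∈ Finset.Icc (1 : ℤ) (n : ℤ),
      indic {ω' | Uv P X i ω' j = s} ω) ≤
      (n : ℝ) ^ (-(1 / 2) : ℝ) + Mn P X n (n : ℝ)⁻¹ μ ω * (n : ℝ) ^ (-μ) := by
  have hn' : (0 : ℝ) < n := by exact_mod_cast hn
  have hninv : (0 : ℝ) < (n : ℝ)⁻¹ := inv_pos.2 hn'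
  set t : ℝ := max 0 (s - (n : ℝ)⁻¹) with ht
  have ht0 : 0 ≤ t := le_max_left _ _
  have hts : t < s := max_lt hs.1 (by linarith)
  have hst : s - t ≤ (n : ℝ)⁻¹ := by linarith [le_max_right 0 (s - (n : ℝ)⁻¹)]
  have hsI : s ∈ Set.Icc (0 : ℝ) 1 := ⟨hs.1.le, hs.2⟩
  have htI : t ∈ Set.Icc (0 : ℝ) 1 := ⟨ht0, hts.le.trans hs.2⟩
  have hd : dist (margPt j s) (margPt j t) = s - t := by
    rw [dist_margPt, abs_of_pos (by linarith)]
  have hmod := abs_alphan_sub_le P X hn (n : ℝ)⁻¹ μ ω (margPt_mem_Icc j hsI)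
    (margPt_mem_Icc j htI) (hd.trans_le hst)
  have hmax : max (dist (margPt j s) (margPt j t) ^ μ) ((n : ℝ) ^ (-μ)) = (n : ℝ) ^ (-μ) := by
    refine max_eq_right ?_
    rw [hd, Real.rpow_neg hn'.le, ← Real.inv_rpow hn'.le]
    exact Real.rpow_le_rpow (by linarith) hst hμ
  rw [hmax, alphan_margPt P X hX j hcont n ω hsI, alphan_margPt P X hX j hcont n ω htI] at hmod
  have hties : (n : ℝ)⁻¹ * ∑ i ∈ Finset.Icc (1 : ℤ) (n : ℤ),
      indic {ω' | Uv P X i ω' j = s} ω ≤ Gnj P X n j s ω - Gnj P X n j t ω := by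
    rw [Gnj, Gnj, ← mul_sub, ← Finset.sum_sub_distrib]
    refine mul_le_mul_of_nonneg_left (Finset.sum_le_sum fun i _ => ?_) hninv.le
    by_cases h : Uv P X i ω j = s
    · rw [indic_of_mem (by exact h), indic_of_mem (by exact h.le),
        indic_of_notMem (s := {ω' | Uv P X i ω' j ≤ t}) (by simp [h, hts])]
      norm_num
    · rw [indic_of_notMem (by exact h)]
      exact sub_nonneg.2 (indic_le_indic fun h' => le_trans h' hts.le)
  have hsqrt : Real.sqrt n * (s - t) ≤ (n : ℝ) ^ (-(1 / 2) : ℝ) := by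
    refine (mul_le_mul_of_nonneg_left hst (Real.sqrt_nonneg _)).trans_eq ?_
    rw [Real.sqrt_eq_rpow, ← Real.rpow_neg_one, ← Real.rpow_add hn']
    norm_num
  have := mul_le_mul_of_nonneg_left hties (Real.sqrt_nonneg (n : ℝ))
  have := (le_abs_self _).trans hmod
  nlinarith

/-- A normalized rank is at most `u` only if the observation is below the empirical
`u`-quantile. -/
lemma Uv_le_genInv_of_pseudoObs_le (P : Measure Ω) [IsProbabilityMeasure P]
    (X : ℤ → Ω → Fin d → ℝ) {n : ℕ} (j : Fin d) (ω : Ω) {u : ℝ} (hu0 : 0 < u) (hu1 : u ≤ 1)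
    {i : ℤ} (hi : i ∈ Finset.Icc (1 : ℤ) (n : ℤ)) (h : pseudoObs X n i ω j ≤ u) :
    Uv P X i ω j ≤ genInv (fun x => Gnj P X n j x ω) u := by
  by_contra! hlt
  have hn : 0 < n := by
    rw [Finset.mem_Icc] at hi
    omega
  have hn' : (0 : ℝ) < n := by exact_mod_cast hn
  rw [genInv, if_neg hu0.ne'] at hlt
  have hne : {x | u ≤ Gnj P X n j x ω}.Nonempty := by
    refine ⟨1, hu1.trans_eq ?_⟩
    rw [Gnj, Finset.sum_congr rfl fun i _ =>
      indic_of_mem (s := {ω' | Uv P X i ω' j ≤ 1}) (Uv_le_one P X i ω j)]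
    simp [hn.ne']
  obtain ⟨x, hx, hxi⟩ := exists_lt_of_csInf_lt hne hlt
  have hx' : (n : ℝ) * u ≤ ∑ k ∈ Finset.Icc (1 : ℤ) (n : ℤ), indic {ω' | Uv P X k ω' j ≤ x} ω := by
    rwa [Set.mem_ofPred_eq, Gnj, le_inv_mul_iff₀ hn'] at hx
  have hsum : ∑ k ∈ Finset.Icc (1 : ℤ) (n : ℤ), indic {ω' | Uv P X k ω' j ≤ x} ω + 1 ≤
      ∑ k ∈ Finset.Icc (1 : ℤ) (n : ℤ), indic {ω' | X k ω' j ≤ X i ω j} ω := by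
    rw [← Finset.add_sum_erase _ _ hi, ← Finset.add_sum_erase _ _ hi,
      indic_of_notMem (s := {ω' | Uv P X i ω' j ≤ x}) (by simpa using hxi),
      indic_of_mem (s := {ω' | X i ω' j ≤ X i ω j}) (by simp), zero_add, add_comm]
    gcongr with k
    exact indic_le_indic fun hk =>
      ((margF_monotone P X j).reflect_lt (lt_of_le_of_lt hk hxi)).le
  have htot : ∑ k ∈ Finset.Icc (1 : ℤ) (n : ℤ), indic {ω' | X k ω' j ≤ X i ω j} ω ≤ n := by
    refine (Finset.sum_le_sum fun k _ => indic_le_one _ _).trans ?_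
    simp
  rw [pseudoObs, empCdfX, div_mul_eq_mul_div, mul_inv_cancel_left₀ hn'.ne',
    div_le_iff₀ (by positivity)] at h
  nlinarith

/-- An observation strictly below the empirical `u`-quantile has normalized rank at most `u`. -/
lemma pseudoObs_le_of_Uv_lt_genInv (P : Measure Ω) [IsProbabilityMeasure P]
    (X : ℤ → Ω → Fin d → ℝ) {n : ℕ} (hn : 0 < n) (j : Fin d) (ω : Ω) {u : ℝ} (hu0 : 0 < u)
    {i : ℤ} (h : Uv P X i ω j < genInv (fun x => Gnj P X n j x ω) u) :
    pseudoObs X n i ω j ≤ u := by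
  have hn' : (0 : ℝ) < n := by exact_mod_cast hn
  rw [genInv, if_neg hu0.ne'] at h
  have hbdd : BddBelow {x | u ≤ Gnj P X n j x ω} := by
    refine ⟨0, fun x hx => ?_⟩
    by_contra! hx0
    have : Gnj P X n j x ω = 0 := by
      rw [Gnj, Finset.sum_eq_zero fun k _ => indic_of_notMem ?_, mul_zero]
      exact fun hk => (hx0.trans_le (Uv_nonneg P X k ω j)).not_ge hk
    rw [Set.mem_ofPred_eq, this] at hx
    exact hx.not_gt hu0
  have hG : Gnj P X n j (Uv P X i ω j) ω < u := lt_of_not_ge fun hle =>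
    (csInf_le hbdd hle).not_gt h
  have hF : empCdfX X n j (X i ω j) ω ≤ Gnj P X n j (Uv P X i ω j) ω := by
    refine mul_le_mul_of_nonneg_left (Finset.sum_le_sum fun k _ => ?_) (by positivity)
    exact indic_le_indic fun hk => margF_monotone P X j hk
  have h0 : 0 ≤ empCdfX X n j (X i ω j) ω :=
    (inv_mul_sum_indic_mem_Icc n (fun k => {ω' | X k ω' j ≤ X i ω j}) ω).1
  refine (mul_le_of_le_one_left h0 ?_).trans (hF.trans hG.le)
  rw [div_le_one (by positivity)]
  linarith

/-- The two versions of the empirical copula differ by at most the proportion of ties. -/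
lemma abs_empCop_sub_copGI_le (P : Measure Ω) [IsProbabilityMeasure P]
    (X : ℤ → Ω → Fin d → ℝ) {n : ℕ} (hn : 0 < n) (ω : Ω) {u : Fin d → ℝ}
    (hu0 : ∀ j, 0 < u j) (hu1 : ∀ j, u j ≤ 1) :
    |empCop X n u ω - copGI P X n u ω| ≤
      ∑ j, (n : ℝ)⁻¹ * ∑ i ∈ Finset.Icc (1 : ℤ) (n : ℤ),
        indic {ω' | Uv P X i ω' j = genInv (fun x => Gnj P X n j x ω) (u j)} ω := by
  set q : Fin d → ℝ := fun j => genInv (fun x => Gnj P X n j x ω) (u j) with hq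
  rw [← Finset.mul_sum, Finset.sum_comm, empCop, copGI, Gn, ← mul_sub, abs_mul,
    abs_of_nonneg (by positivity : (0 : ℝ) ≤ (n : ℝ)⁻¹), ← Finset.sum_sub_distrib]
  refine mul_le_mul_of_nonneg_left ((Finset.abs_sum_le_sum_abs _ _).trans
    (Finset.sum_le_sum fun i hi => ?_)) (by positivity)
  have hnn : ∀ j ∈ Finset.univ, 0 ≤ indic {ω' | Uv P X i ω' j = q j} ω :=
    fun j _ => indic_nonneg _ _
  have hAB : (∀ j, pseudoObs X n i ω j ≤ u j) → ∀ j, Uv P X i ω j ≤ q j := fun h j =>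
    Uv_le_genInv_of_pseudoObs_le P X j ω (hu0 j) (hu1 j) hi (h j)
  by_cases hB : ∀ j, Uv P X i ω j ≤ q j
  · by_cases hA : ∀ j, pseudoObs X n i ω j ≤ u j
    · rw [indic_of_mem (by exact hA), indic_of_mem (by exact hB)]
      simpa using Finset.sum_nonneg hnn
    · rw [indic_of_notMem (by exact hA), indic_of_mem (by exact hB)]
      push Not at hA
      obtain ⟨j, hj⟩ := hA
      have hj' : Uv P X i ω j = q j := (hB j).antisymm <| not_lt.1 fun h =>
        (pseudoObs_le_of_Uv_lt_genInv P X hn j ω (hu0 j) h).not_gt hj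
      calc |(0 : ℝ) - 1| = indic {ω' | Uv P X i ω' j = q j} ω := by
            rw [indic_of_mem (by exact hj')]
            norm_num
        _ ≤ _ := Finset.single_le_sum hnn (Finset.mem_univ j)
  · rw [indic_of_notMem (by exact fun hA => hB (hAB hA)), indic_of_notMem (by exact hB)]
    simpa using Finset.sum_nonneg hnn

/-- On a sample without zeros, the weighted distance between the two empirical copula processes
is controlled by the weighted modulus of continuity. -/
lemma abs_weighted_sub_le (P : Measure Ω) [IsProbabilityMeasure P] (X : ℤ → Ω → Fin d → ℝ)
    (hX : Measurable (X 0)) (hcont : ∀ j, Continuous (margF P X j)) {n : ℕ} (hn : 0 < n)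
    {μ : ℝ} (hμ : 0 ≤ μ) {c w : ℝ} (hc : 0 < c) (hw : 0 ≤ w) (ω : Ω)
    (hpos : ∀ i j, 0 < Uv P X i ω j) (hM : Mn P X n (n : ℝ)⁻¹ μ ω ≤ 1)
    {b : ℝ} {u : Fin d → ℝ} (hu : u ∈ NN d (c / n) b) :
    |hatCP P X n u ω / gW w u - CPgi P X n u ω / gW w u| ≤
      d * ((n : ℝ) ^ (-(1 / 2) : ℝ) + (n : ℝ) ^ (-μ)) / (c / n) ^ w := by
  have hn' : (0 : ℝ) < n := by exact_mod_cast hn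
  have hcn : 0 < c / n := by positivity
  obtain ⟨hu01, hg, -⟩ := hu
  have hu0 : ∀ j, 0 < u j := fun j => hcn.trans <| hg.trans_le <| (min_le_left _ _).trans <|
    ciInf_le (Set.finite_range _).bddBelow j
  have hgW : (c / n) ^ w ≤ gW w u := Real.rpow_le_rpow hcn.le hg.le hw
  have hgc : 0 < (c / n) ^ w := Real.rpow_pos_of_pos hcn w
  have hrate : 0 ≤ (n : ℝ) ^ (-(1 / 2) : ℝ) + (n : ℝ) ^ (-μ) := by positivity
  rw [← sub_div, abs_div, abs_of_pos (hgc.trans_le hgW)]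
  refine div_le_div₀ (mul_nonneg (Nat.cast_nonneg d) hrate) ?_ hgc hgW
  rw [hatCP, CPgi, ← mul_sub, sub_sub_sub_cancel_right, abs_mul,
    abs_of_nonneg (Real.sqrt_nonneg _)]
  refine (mul_le_mul_of_nonneg_left (abs_empCop_sub_copGI_le P X hn ω hu0
    fun j => (hu01 j).2) (Real.sqrt_nonneg _)).trans ?_
  rw [Finset.mul_sum]
  refine (Finset.sum_le_sum fun j _ => ?_).trans_eq
    (b := ∑ _j : Fin d, ((n : ℝ) ^ (-(1 / 2) : ℝ) + (n : ℝ) ^ (-μ)))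
    (by rw [Finset.sum_const, Finset.card_fin, nsmul_eq_mul])
  by_cases hties : ∃ i, Uv P X i ω j = genInv (fun x => Gnj P X n j x ω) (u j)
  · obtain ⟨i, hi⟩ := hties
    refine (sqrt_mul_ties_le P X hX j (hcont j) hn hμ ω
      (hi ▸ ⟨hpos i j, Uv_le_one P X i ω j⟩)).trans ?_
    gcongr
    exact mul_le_of_le_one_left (by positivity) hM
  · rw [Finset.sum_eq_zero fun i _ => indic_of_notMem (s := {ω' | Uv P X i ω' j =
      genInv (fun x => Gnj P X n j x ω) (u j)}) fun hi => hties ⟨i, hi⟩]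
    simpa using hrate

lemma tendsto_weighted_rate (d : ℕ) {c w μ : ℝ} (hc : 0 < c) (hw : w < 1 / 2) (hμ : w < μ) :
    Tendsto (fun n : ℕ => d * ((n : ℝ) ^ (-(1 / 2) : ℝ) + (n : ℝ) ^ (-μ)) / (c / n) ^ w)
      atTop (nhds 0) := by
  have h1 := (tendsto_rpow_neg_atTop (sub_pos.2 hw)).comp tendsto_natCast_atTop_atTop
  have h2 := (tendsto_rpow_neg_atTop (sub_pos.2 hμ)).comp tendsto_natCast_atTop_atTop
  have h := (h1.add h2).const_mul (d / c ^ w)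
  rw [add_zero, mul_zero] at h
  refine h.congr' ?_
  filter_upwards [eventually_gt_atTop 0] with n hn
  have hn' : (0 : ℝ) < n := by exact_mod_cast hn
  have hcw : 0 < c ^ w := Real.rpow_pos_of_pos hc w
  have hnw : 0 < (n : ℝ) ^ w := Real.rpow_pos_of_pos hn' w
  simp only [Function.comp_apply]
  rw [show -(1 / 2 - w) = -(1 / 2) + w by ring, show -(μ - w) = -μ + w by ring,
    Real.rpow_add hn', Real.rpow_add hn', Real.div_rpow hc.le hn'.le]
  field_simp

/-- Lemma 4.6: the empirical copula process and its generalized-inverse version are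
uniformly close on `N(c/n, 1/2)` after weighting. -/
theorem weighted_comparison_hatCP_CPgi
    {Ω : Type*} [MeasurableSpace Ω] {d : ℕ} (hd : 2 ≤ d)
    (P : Measure Ω) [IsProbabilityMeasure P] (X : ℤ → Ω → Fin d → ℝ)
    (hmeas : ∀ i, Measurable (X i)) (hstat : StrictlyStationary P X)
    (hcont : ∀ j, Continuous (margF P X j))
    (θ₁ θ₂ θ₃ : ℝ) (hθ₁ : θ₁ ∈ Set.Ioc (0 : ℝ) (1/2)) (hθ₂ : θ₂ ∈ Set.Ioc (0 : ℝ) (1/2))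
    (hθ₃ : θ₃ ∈ Set.Ioc (1/2 : ℝ) 1)
    (hC : Condition21 (cop P X)) (h41 : Condition41 P X θ₁) (h43 : Condition43 P X θ₂ θ₃) :
    ∀ c ∈ Set.Ioo (0 : ℝ) 1, ∀ w ∈ Set.Ioo (0 : ℝ) (min (θ₁ / (2 * (1 - θ₁))) (min (θ₂ / (2 * (1 - θ₂))) (θ₃ - 1/2))),
      oP1 P (fun n ω =>
        ⨆ u ∈ NN d (c / n) (1/2),
          |hatCP P X n u ω / gW w u - CPgi P X n u ω / gW w u|) := by
  intro c hc w hw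
  have hwθ : w < θ₁ := by
    have h1 : w < θ₁ / (2 * (1 - θ₁)) := hw.2.trans_le (min_le_left _ _)
    have h2 : 1 ≤ 2 * (1 - θ₁) := by linarith [hθ₁.2]
    exact h1.trans_le (div_le_self hθ₁.1.le h2)
  obtain ⟨μ, hwμ, hμθ⟩ := exists_between hwθ
  have hμ0 : 0 < μ := hw.1.trans hwμ
  intro ε hε
  have hM := h41 μ ⟨hμ0, hμθ⟩ (fun n => (n : ℝ)⁻¹) tendsto_inv_atTop_nhds_zero_nat 1 one_pos
  have hnull : P {ω | ∃ i j, Uv P X i ω j ≤ 0} = 0 := by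
    simp only [Set.ofPred_exists, measure_iUnion_null_iff]
    exact fun i j => measure_Uv_nonpos P X hmeas hstat j (hcont j) i
  refine tendsto_of_tendsto_of_tendsto_of_le_of_le' tendsto_const_nhds hM
    (Eventually.of_forall fun _ => zero_le) ?_
  filter_upwards [eventually_gt_atTop 0, (tendsto_weighted_rate d hc.1
    (hwθ.trans_le hθ₁.2) hwμ).eventually (gt_mem_nhds hε)] with n hn hrate
  refine (measure_mono (t := {ω | 1 * 1 < |Mn P X n (n : ℝ)⁻¹ μ ω|} ∪
    {ω | ∃ i j, Uv P X i ω j ≤ 0}) fun ω (hω : ε * 1 < _) => ?_).trans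
    ((measure_union_le _ _).trans_eq (by rw [hnull, add_zero]))
  by_contra hcon
  rw [Set.mem_union, not_or, Set.mem_ofPred_eq, Set.mem_ofPred_eq] at hcon
  push Not at hcon
  have hM1 : Mn P X n (n : ℝ)⁻¹ μ ω ≤ 1 :=
    (le_abs_self _).trans (hcon.1.trans_eq (mul_one 1))
  refine hω.not_ge ?_
  rw [mul_one, abs_of_nonneg (Real.iSup_nonneg fun u => Real.iSup_nonneg fun _ => abs_nonneg _)]
  exact Real.iSup_le (fun u => Real.iSup_le (fun hu => (abs_weighted_sub_le P X (hmeas 0) hcont hn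
    hμ0.le hc.1 hw.1.le ω hcon.2 hM1 hu).trans hrate.le) hε.le) hε.le

end BBV
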